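/- Let N be a positive integer, 0 < s < 1 with N > 2s, α > -2s, λ > 0 and C̄ > 0. There exists δ₀ > 0, depending only on N, s, α, λ, C̄, with the following property. Suppose Ω is an open subset of the annulus {x ∈ ℝ^N : λ - δ₀ < |x| < λ}, and v ∈ L_{2s} is C^{1,1} on a neighbourhood of each point of ℝ^N ∖ {0}, is continuous on {x : 0 < |x| ≤ λ}, and satisfies: (i) v(x) = -v_λ(x) for every x ≠ 0 (Kelvin antisymmetry); (ii) (-Δ)^s v(x) - C̄ |x|^α v(x) ≥ 0 for every x ∈ Ω; (iii) v(x) ≥ 0 for every x with 0 < |x| < λ and x ∉ Ω. Then v(x) ≥ 0 for every x ∈ Ω. -/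

import Mathlib

open MeasureTheory Filter Set

/-- The principal-value fractional Laplacian: `IsFracLapAt N s u x L` means that
`lim_{ε→0⁺} ∫_{|y-x|>ε} (u(x)-u(y))/|x-y|^{N+2s} dy` exists and equals `L`. -/
def IsFracLapAt (N : ℕ) (s : ℝ) (u : EuclideanSpace ℝ (Fin N) → ℝ)
    (x : EuclideanSpace ℝ (Fin N)) (L : ℝ) : Prop :=
  Filter.Tendsto (fun ε : ℝ =>
      ∫ y in {y : EuclideanSpace ℝ (Fin N) | ε < ‖y - x‖},
        (u x - u y) / ‖x - y‖ ^ ((N : ℝ) + 2 * s))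
    (nhdsWithin 0 (Set.Ioi 0)) (nhds L)

/-- The Kelvin transform `u_λ(x) = (λ/|x|)^{N-2s} u(λ²x/|x|²)`. -/
noncomputable def kelvinTransform (N : ℕ) (s lam : ℝ)
    (u : EuclideanSpace ℝ (Fin N) → ℝ) (x : EuclideanSpace ℝ (Fin N)) : ℝ :=
  (lam / ‖x‖) ^ ((N : ℝ) - 2 * s) * u ((lam ^ 2 / ‖x‖ ^ 2) • x)

/-- `u` is `C^{1,1}` on a neighbourhood of `x`. -/
def C11Near (N : ℕ) (u : EuclideanSpace ℝ (Fin N) → ℝ)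
    (x : EuclideanSpace ℝ (Fin N)) : Prop :=
  ∃ ε > 0, ContDiffOn ℝ 1 u (Metric.ball x ε) ∧
    ∃ K : NNReal, LipschitzOnWith K (fderiv ℝ u) (Metric.ball x ε)

lemma measurableSet_punctured_ball {E : Type*} [NormedAddCommGroup E] [MeasurableSpace E]
    [BorelSpace E] (lam : ℝ) : MeasurableSet {z : E | 0 < ‖z‖ ∧ ‖z‖ < lam} :=
  (measurableSet_lt measurable_const measurable_norm).inter
    (measurableSet_lt measurable_norm measurable_const)

lemma measurableSet_lt_norm_sub {E : Type*} [NormedAddCommGroup E] [MeasurableSpace E]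
    [BorelSpace E] (ε : ℝ) (x : E) : MeasurableSet {y : E | ε < ‖y - x‖} :=
  measurableSet_lt measurable_const (measurable_id.sub_const x).norm

section Inversion

variable {E : Type*} [NormedAddCommGroup E] [InnerProductSpace ℝ E]

lemma inversion_zero_eq_smul (lam : ℝ) (z : E) :
    EuclideanGeometry.inversion 0 lam z = (lam ^ 2 / ‖z‖ ^ 2) • z := by
  simp [EuclideanGeometry.inversion, div_pow]

lemma norm_inversion_zero (lam : ℝ) (z : E) :
    ‖EuclideanGeometry.inversion 0 lam z‖ = lam ^ 2 / ‖z‖ := by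
  simpa using EuclideanGeometry.dist_inversion_center (0 : E) z lam

lemma image_inversion_punctured_ball {lam : ℝ} (hlam : 0 < lam) :
    EuclideanGeometry.inversion (0 : E) lam '' {z | 0 < ‖z‖ ∧ ‖z‖ < lam} = {y | lam < ‖y‖} := by
  ext y
  constructor
  · rintro ⟨z, ⟨h0, h1⟩, rfl⟩
    rw [mem_ofPred_eq, norm_inversion_zero, lt_div_iff₀ h0]
    nlinarith
  · intro (hy : lam < ‖y‖)
    have hy0 : 0 < ‖y‖ := hlam.trans hy
    refine ⟨EuclideanGeometry.inversion 0 lam y, ?_,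
      EuclideanGeometry.inversion_inversion 0 hlam.ne' y⟩
    rw [mem_ofPred_eq, norm_inversion_zero]
    refine ⟨by positivity, ?_⟩
    rw [div_lt_iff₀ hy0]
    nlinarith

/-- The squared distance from `x` to the inversion of `z`, rescaled by `‖z‖ / lam`. -/
lemma sq_dist_inversion_mul {lam : ℝ} (hlam : lam ≠ 0) (x : E) {z : E} (hz : z ≠ 0) :
    (‖x - EuclideanGeometry.inversion 0 lam z‖ * (‖z‖ / lam)) ^ 2 =
      ‖x - z‖ ^ 2 + (lam ^ 2 - ‖x‖ ^ 2) * (lam ^ 2 - ‖z‖ ^ 2) / lam ^ 2 := by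
  have hz' : ‖z‖ ≠ 0 := norm_ne_zero_iff.mpr hz
  rw [mul_pow, norm_sub_sq_real, norm_sub_sq_real, norm_inversion_zero, inversion_zero_eq_smul,
    inner_smul_right]
  field_simp
  ring

lemma norm_sub_le_dist_inversion_mul {lam : ℝ} (hlam : 0 < lam) {x z : E} (hz : z ≠ 0)
    (hx : ‖x‖ ≤ lam) (hz' : ‖z‖ ≤ lam) :
    ‖x - z‖ ≤ ‖x - EuclideanGeometry.inversion 0 lam z‖ * (‖z‖ / lam) := by
  refine le_of_sq_le_sq ?_ (by positivity)
  rw [sq_dist_inversion_mul hlam.ne' x hz]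
  have h1 : 0 ≤ lam ^ 2 - ‖x‖ ^ 2 := by nlinarith [norm_nonneg x]
  have h2 : 0 ≤ lam ^ 2 - ‖z‖ ^ 2 := by nlinarith [norm_nonneg z]
  have := div_nonneg (mul_nonneg h1 h2) (sq_nonneg lam)
  linarith

lemma hasFDerivWithinAt_inversion_zero (lam : ℝ) (z : E)
    (hz : z ∈ {z : E | 0 < ‖z‖ ∧ ‖z‖ < lam}) :
    HasFDerivWithinAt (EuclideanGeometry.inversion (0 : E) lam)
      ((lam / dist z 0) ^ 2 • (((ℝ ∙ (z - 0))ᗮ).reflection : E →L[ℝ] E))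
      {z : E | 0 < ‖z‖ ∧ ‖z‖ < lam} z :=
  (EuclideanGeometry.hasFDerivAt_inversion (norm_pos_iff.mp hz.1)).hasFDerivWithinAt

variable [FiniteDimensional ℝ E]

lemma abs_det_smul_reflection (K : Submodule ℝ E) (c : ℝ) :
    |(c • (K.reflection : E →L[ℝ] E)).det| = |c| ^ Module.finrank ℝ E := by
  have h : LinearMap.det ((K.reflection : E →L[ℝ] E) : E →ₗ[ℝ] E) =
      (-1) ^ Module.finrank ℝ Kᗮ := K.det_reflection
  rw [ContinuousLinearMap.det, ContinuousLinearMap.toLinearMap_smul, LinearMap.det_smul, h]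
  simp [abs_mul, abs_pow]

lemma abs_det_fderiv_inversion_zero (lam : ℝ) (z : E) :
    |((lam / dist z 0) ^ 2 • (((ℝ ∙ (z - 0))ᗮ).reflection : E →L[ℝ] E)).det| =
      ((lam / ‖z‖) ^ 2) ^ Module.finrank ℝ E := by
  rw [abs_det_smul_reflection, abs_of_nonneg (sq_nonneg _), dist_zero_right]

variable [MeasurableSpace E] [BorelSpace E]

/-- Change of variables for the inversion that exchanges the two sides of a sphere. -/
lemma setIntegral_exterior_eq {lam : ℝ} (hlam : 0 < lam) (f : E → ℝ) :
    ∫ y in {y : E | lam < ‖y‖}, f y =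
      ∫ z in {z : E | 0 < ‖z‖ ∧ ‖z‖ < lam}, ((lam / ‖z‖) ^ 2) ^ Module.finrank ℝ E *
        f (EuclideanGeometry.inversion 0 lam z) := by
  rw [← image_inversion_punctured_ball hlam,
    integral_image_eq_integral_abs_det_fderiv_smul volume (measurableSet_punctured_ball lam)
      (hasFDerivWithinAt_inversion_zero lam)
      (EuclideanGeometry.inversion_injective 0 hlam.ne').injOn]
  simp only [abs_det_fderiv_inversion_zero, smul_eq_mul]

lemma integrableOn_exterior_iff {lam : ℝ} (hlam : 0 < lam) (f : E → ℝ) :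
    IntegrableOn f {y : E | lam < ‖y‖} ↔
      IntegrableOn (fun z => ((lam / ‖z‖) ^ 2) ^ Module.finrank ℝ E *
        f (EuclideanGeometry.inversion 0 lam z)) {z : E | 0 < ‖z‖ ∧ ‖z‖ < lam} := by
  rw [← image_inversion_punctured_ball hlam,
    integrableOn_image_iff_integrableOn_abs_det_fderiv_smul volume
      (measurableSet_punctured_ball lam) (hasFDerivWithinAt_inversion_zero lam)
      (EuclideanGeometry.inversion_injective 0 hlam.ne').injOn]
  simp only [abs_det_fderiv_inversion_zero, smul_eq_mul]

end Inversion

lemma one_add_rpow_norm_le {E : Type*} [NormedAddCommGroup E] {p ε : ℝ} (hp : 0 ≤ p) (hε : 0 < ε)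
    {x y : E} (hy : ε < ‖y - x‖) :
    1 + ‖y‖ ^ p ≤ ((1 / ε) ^ p + (1 + ‖x‖ / ε) ^ p) * ‖x - y‖ ^ p := by
  have hr : 0 < ‖y - x‖ := hε.trans hy
  have h1 : 1 ≤ ‖y - x‖ / ε := (one_le_div hε).2 hy.le
  rw [norm_sub_rev x y, add_mul, ← Real.mul_rpow (by positivity) hr.le,
    ← Real.mul_rpow (by positivity) hr.le]
  refine add_le_add (Real.one_le_rpow (by rwa [one_div, ← div_eq_inv_mul]) hp)
    (Real.rpow_le_rpow (norm_nonneg y) ?_ hp)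
  calc ‖y‖ = ‖(y - x) + x‖ := by rw [sub_add_cancel]
    _ ≤ ‖y - x‖ + ‖x‖ * 1 := by simpa using norm_add_le (y - x) x
    _ ≤ ‖y - x‖ + ‖x‖ * (‖y - x‖ / ε) := by gcongr
    _ = (1 + ‖x‖ / ε) * ‖y - x‖ := by ring

section Integrability

variable {E : Type*} [NormedAddCommGroup E] [NormedSpace ℝ E] [FiniteDimensional ℝ E]
  [MeasurableSpace E] [BorelSpace E] {μ : Measure E} [μ.IsAddHaarMeasure]

lemma integrableOn_inv_rpow_norm_sub {p ε : ℝ} (hp : (Module.finrank ℝ E : ℝ) < p) (hε : 0 < ε)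
    (x : E) : IntegrableOn (fun y => (‖x - y‖ ^ p)⁻¹) {y | ε < ‖y - x‖} μ := by
  have hp0 : 0 ≤ p := (Nat.cast_nonneg _).trans hp.le
  have hint : Integrable (fun y => (1 / ε + 1) ^ p * (1 + ‖y - x‖) ^ (-p)) μ :=
    ((integrable_one_add_norm (μ := μ) hp).comp_sub_right x).const_mul _
  refine hint.integrableOn.mono' (Measurable.aestronglyMeasurable (by fun_prop)) ?_
  refine (ae_restrict_iff' (measurableSet_lt_norm_sub ε x)).2 (Eventually.of_forall ?_)
  intro y (hy : ε < ‖y - x‖)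
  have hr : 0 < ‖y - x‖ := hε.trans hy
  rw [norm_sub_rev x y, Real.norm_of_nonneg (by positivity), Real.rpow_neg (by positivity),
    ← div_eq_mul_inv, inv_eq_one_div, div_le_div_iff₀ (by positivity) (by positivity), one_mul,
    ← Real.mul_rpow (by positivity) hr.le]
  refine Real.rpow_le_rpow (by positivity) ?_ hp0
  have : 1 ≤ 1 / ε * ‖y - x‖ := by
    rw [one_div, ← div_eq_inv_mul, one_le_div hε]; exact hy.le
  linarith

lemma integrableOn_fracLap_kernel {p ε : ℝ} (hp : (Module.finrank ℝ E : ℝ) < p) (hε : 0 < ε)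
    {u : E → ℝ} (hu : AEStronglyMeasurable u μ)
    (hint : Integrable (fun y => |u y| / (1 + ‖y‖ ^ p)) μ) (c : ℝ) (x : E) :
    IntegrableOn (fun y => (c - u y) / ‖x - y‖ ^ p) {y | ε < ‖y - x‖} μ := by
  have hp0 : 0 ≤ p := (Nat.cast_nonneg _).trans hp.le
  have hsub : (fun y => (c - u y) / ‖x - y‖ ^ p) =
      fun y => c * (‖x - y‖ ^ p)⁻¹ - u y * (‖x - y‖ ^ p)⁻¹ := by
    ext y; ring
  rw [hsub]
  refine ((integrableOn_inv_rpow_norm_sub hp hε x).const_mul c).sub ?_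
  have hmeas : Measurable fun y : E => (‖x - y‖ ^ p)⁻¹ := by fun_prop
  refine (hint.const_mul ((1 / ε) ^ p + (1 + ‖x‖ / ε) ^ p)).integrableOn.mono'
    (hu.mul hmeas.aestronglyMeasurable).restrict ?_
  refine (ae_restrict_iff' (measurableSet_lt_norm_sub ε x)).2 (Eventually.of_forall ?_)
  intro y (hy : ε < ‖y - x‖)
  have hr : 0 < ‖x - y‖ := by rw [norm_sub_rev]; exact hε.trans hy
  rw [norm_mul, Real.norm_eq_abs, Real.norm_of_nonneg (by positivity), mul_div_left_comm]
  gcongr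
  rw [inv_eq_one_div, div_le_div_iff₀ (by positivity) (by positivity), one_mul]
  exact one_add_rpow_norm_le hp0 hε hy

end Integrability

lemma C11Near.continuousAt {N : ℕ} {u : EuclideanSpace ℝ (Fin N) → ℝ}
    {x : EuclideanSpace ℝ (Fin N)} (h : C11Near N u x) : ContinuousAt u x := by
  obtain ⟨ε, hε, hu, -⟩ := h
  exact hu.continuousOn.continuousAt (Metric.ball_mem_nhds x hε)

lemma aestronglyMeasurable_of_continuousAt_ne_zero {E : Type*} [NormedAddCommGroup E]
    [SecondCountableTopology E] [MeasurableSpace E] [BorelSpace E] {μ : Measure E}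
    [NullSingletonClass μ] {u : E → ℝ} (h : ∀ x, x ≠ 0 → ContinuousAt u x) :
    AEStronglyMeasurable u μ := by
  have hc : ContinuousOn u {0}ᶜ := fun x hx => (h x hx).continuousWithinAt
  have := hc.aestronglyMeasurable (μ := μ) (measurableSet_singleton (0 : E)).compl
  rwa [restrict_compl_singleton] at this

lemma div_le_div_of_nonpos_left {a b c : ℝ} (ha : a ≤ 0) (hb : 0 < b) (hbc : b ≤ c) :
    a / b ≤ a / c := by
  simpa only [div_eq_mul_inv] using
    mul_le_mul_of_nonpos_left (inv_anti₀ hb hbc) ha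

section Kelvin

variable {N : ℕ} {s lam : ℝ} {v : EuclideanSpace ℝ (Fin N) → ℝ} {x z : EuclideanSpace ℝ (Fin N)}

lemma kelvinTransform_inversion (hlam : 0 < lam) (hz : 0 < ‖z‖) :
    kelvinTransform N s lam v (EuclideanGeometry.inversion 0 lam z) =
      (‖z‖ / lam) ^ ((N : ℝ) - 2 * s) * v z := by
  rw [kelvinTransform, ← inversion_zero_eq_smul,
    EuclideanGeometry.inversion_inversion 0 hlam.ne', norm_inversion_zero]
  congr 2
  field_simp

/-- The kernel of the exterior integral, pulled back by the inversion, for a function which is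
antisymmetric under the Kelvin transform. -/
lemma fracLap_kernel_inversion (hlam : 0 < lam) (hz : 0 < ‖z‖)
    (hv : ∀ y, y ≠ 0 → v y = -kelvinTransform N s lam v y) (c : ℝ) :
    ((lam / ‖z‖) ^ 2) ^ Module.finrank ℝ (EuclideanSpace ℝ (Fin N)) *
        ((c - v (EuclideanGeometry.inversion 0 lam z)) /
          ‖x - EuclideanGeometry.inversion 0 lam z‖ ^ ((N : ℝ) + 2 * s)) =
      ((lam / ‖z‖) ^ ((N : ℝ) - 2 * s) * c + v z) /
        (‖x - EuclideanGeometry.inversion 0 lam z‖ * (‖z‖ / lam)) ^ ((N : ℝ) + 2 * s) := by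
  have hy : EuclideanGeometry.inversion (0 : EuclideanSpace ℝ (Fin N)) lam z ≠ 0 := by
    rw [Ne, EuclideanGeometry.inversion_eq_center hlam.ne']
    exact norm_pos_iff.mp hz
  have ht : 0 < lam / ‖z‖ := div_pos hlam hz
  have hpow : ((lam / ‖z‖) ^ 2) ^ N =
      (lam / ‖z‖) ^ ((N : ℝ) - 2 * s) * (lam / ‖z‖) ^ ((N : ℝ) + 2 * s) := by
    rw [← Real.rpow_add ht, ← pow_mul, ← Real.rpow_natCast]
    congr 1
    push_cast
    ring
  rw [hv _ hy, kelvinTransform_inversion hlam hz, finrank_euclideanSpace_fin, hpow,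
    Real.mul_rpow (norm_nonneg _) (by positivity), ← inv_div lam ‖z‖, Real.inv_rpow ht.le,
    Real.inv_rpow ht.le]
  have ha := Real.rpow_pos_of_pos ht ((N : ℝ) - 2 * s)
  have hb := Real.rpow_pos_of_pos ht ((N : ℝ) + 2 * s)
  field_simp
  ring

/-- At a negative minimum, the kernel and its reflection add up to a negative quantity. -/
lemma fracLap_kernel_add_inversion_le (hs : 0 < s) (hNs : 2 * s < N) (hlam : 0 < lam)
    (hx : ‖x‖ ≤ lam) (hz : 0 < ‖z‖) (hz' : ‖z‖ < lam) (hxz : x ≠ z)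
    (hv : ∀ y, y ≠ 0 → v y = -kelvinTransform N s lam v y) {c : ℝ} (hc : c < 0) (hcv : c ≤ v z) :
    (c - v z) / ‖x - z‖ ^ ((N : ℝ) + 2 * s) +
      ((lam / ‖z‖) ^ 2) ^ Module.finrank ℝ (EuclideanSpace ℝ (Fin N)) *
        ((c - v (EuclideanGeometry.inversion 0 lam z)) /
          ‖x - EuclideanGeometry.inversion 0 lam z‖ ^ ((N : ℝ) + 2 * s)) ≤
      2 * c / (‖x - EuclideanGeometry.inversion 0 lam z‖ * (‖z‖ / lam)) ^ ((N : ℝ) + 2 * s) := by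
  rw [fracLap_kernel_inversion hlam hz hv]
  have hr : 0 < ‖x - z‖ := norm_pos_iff.mpr (sub_ne_zero.mpr hxz)
  have hle := norm_sub_le_dist_inversion_mul hlam (norm_pos_iff.mp hz) hx hz'.le
  have hD := hr.trans_le hle
  have ht : 1 ≤ (lam / ‖z‖) ^ ((N : ℝ) - 2 * s) :=
    Real.one_le_rpow ((one_le_div hz).2 hz'.le) (by linarith)
  set D := ‖x - EuclideanGeometry.inversion 0 lam z‖ * (‖z‖ / lam)
  have hpow : ‖x - z‖ ^ ((N : ℝ) + 2 * s) ≤ D ^ ((N : ℝ) + 2 * s) :=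
    Real.rpow_le_rpow hr.le hle (by positivity)
  have hfirst : (c - v z) / ‖x - z‖ ^ ((N : ℝ) + 2 * s) ≤ (c - v z) / D ^ ((N : ℝ) + 2 * s) :=
    div_le_div_of_nonpos_left (by linarith) (by positivity) hpow
  calc _ ≤ (c - v z) / D ^ ((N : ℝ) + 2 * s) +
        ((lam / ‖z‖) ^ ((N : ℝ) - 2 * s) * c + v z) / D ^ ((N : ℝ) + 2 * s) := by gcongr
    _ = (c - v z + ((lam / ‖z‖) ^ ((N : ℝ) - 2 * s) * c + v z)) / D ^ ((N : ℝ) + 2 * s) := by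
      ring
    _ ≤ _ := by
      gcongr
      nlinarith

/-- Points of the ball of radius `δ` about `(1 - 3δ / ‖x‖) x` lie inside the ball of radius `lam`,
away from `x`, and their reflected distance to `x` is at most `6δ`. -/
lemma near_sphere_ball_bounds {δ : ℝ} (hlam : 0 < lam) (hδ : 0 < δ) (hδlam : 10 * δ ≤ lam)
    (hx : lam - δ < ‖x‖) (hx' : ‖x‖ < lam) (hz : z ∈ Metric.ball ((1 - 3 * δ / ‖x‖) • x) δ) :
    0 < ‖z‖ ∧ ‖z‖ < lam ∧ δ < ‖z - x‖ ∧
      ‖x - EuclideanGeometry.inversion 0 lam z‖ * (‖z‖ / lam) ≤ 6 * δ := by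
  rw [Metric.mem_ball, dist_eq_norm] at hz
  have hx0 : 0 < ‖x‖ := by linarith
  have hp : ‖(1 - 3 * δ / ‖x‖) • x‖ = ‖x‖ - 3 * δ := by
    rw [norm_smul, Real.norm_of_nonneg (by rw [sub_nonneg, div_le_one hx0]; linarith)]
    field_simp
  have hpx : ‖(1 - 3 * δ / ‖x‖) • x - x‖ = 3 * δ := by
    rw [sub_smul, one_smul, sub_sub_cancel_left, norm_neg, norm_smul,
      Real.norm_of_nonneg (by positivity)]
    field_simp
  have h1 := abs_le.1 (abs_norm_sub_norm_le z ((1 - 3 * δ / ‖x‖) • x))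
  rw [hp] at h1
  have h2 := norm_sub_le_norm_sub_add_norm_sub z ((1 - 3 * δ / ‖x‖) • x) x
  have h3 := norm_sub_le_norm_sub_add_norm_sub ((1 - 3 * δ / ‖x‖) • x) z x
  rw [norm_sub_rev _ z] at h3
  rw [hpx] at h2 h3
  have hz0 : 0 < ‖z‖ := by linarith
  have hzlam : ‖z‖ < lam := by linarith
  refine ⟨hz0, hzlam, by linarith, le_of_sq_le_sq ?_ (by positivity)⟩
  rw [sq_dist_inversion_mul hlam.ne' x (norm_pos_iff.mp hz0), norm_sub_rev]
  have h4 : ‖z - x‖ ^ 2 ≤ (4 * δ) ^ 2 := by gcongr; linarith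
  have h5 : lam ^ 2 - ‖x‖ ^ 2 ≤ 2 * lam * δ := by nlinarith
  have h6 : lam ^ 2 - ‖z‖ ^ 2 ≤ 10 * lam * δ := by nlinarith
  have h7 : 0 ≤ lam ^ 2 - ‖z‖ ^ 2 := by nlinarith
  have h8 : (lam ^ 2 - ‖x‖ ^ 2) * (lam ^ 2 - ‖z‖ ^ 2) / lam ^ 2 ≤ 20 * δ ^ 2 := by
    rw [div_le_iff₀ (by positivity)]
    calc _ ≤ (2 * lam * δ) * (10 * lam * δ) := mul_le_mul h5 h6 h7 (by positivity)
      _ = _ := by ring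
  linarith

/-- The truncated fractional Laplacian at a negative interior minimum close to the sphere. -/
lemma truncated_fracLap_le_of_negative_min {δ ε : ℝ} (hN : 0 < N) (hs : 0 < s) (hNs : 2 * s < N)
    (hlam : 0 < lam) (hδ : 0 < δ) (hδlam : 10 * δ ≤ lam)
    (hx : lam - δ < ‖x‖) (hx' : ‖x‖ < lam) (hε : 0 < ε) (hεδ : ε < δ) (hεx : ε < lam - ‖x‖)
    (hmeas : AEStronglyMeasurable v)
    (hint : Integrable (fun y => |v y| / (1 + ‖y‖ ^ ((N : ℝ) + 2 * s))))
    (hv : ∀ y, y ≠ 0 → v y = -kelvinTransform N s lam v y)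
    (hneg : v x < 0) (hmin : ∀ z, 0 < ‖z‖ → ‖z‖ < lam → v x ≤ v z)
    (hnear : ∀ z, ‖z - x‖ ≤ ε → v z ≤ 0) :
    ∫ y in {y | ε < ‖y - x‖}, (v x - v y) / ‖x - y‖ ^ ((N : ℝ) + 2 * s) ≤
      2 * v x / (6 * δ) ^ ((N : ℝ) + 2 * s) *
        volume.real (Metric.ball ((1 - 3 * δ / ‖x‖) • x) δ) := by
  have : Nonempty (Fin N) := ⟨⟨0, hN⟩⟩
  set p : ℝ := (N : ℝ) + 2 * s with hp
  set F := fun y => (v x - v y) / ‖x - y‖ ^ p with hF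
  set A := {y : EuclideanSpace ℝ (Fin N) | ε < ‖y - x‖} with hA
  set B := {z : EuclideanSpace ℝ (Fin N) | 0 < ‖z‖ ∧ ‖z‖ < lam}
  set W := {y : EuclideanSpace ℝ (Fin N) | lam < ‖y‖}
  set S := Metric.ball ((1 - 3 * δ / ‖x‖) • x) δ
  set G := fun z => ((lam / ‖z‖) ^ 2) ^ Module.finrank ℝ (EuclideanSpace ℝ (Fin N)) *
    F (EuclideanGeometry.inversion 0 lam z) with hG
  have hAm : MeasurableSet A := measurableSet_lt_norm_sub ε x
  have hBm : MeasurableSet B := measurableSet_punctured_ball lam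
  have hWm : MeasurableSet W := measurableSet_lt measurable_const measurable_norm
  have hFA : IntegrableOn F A :=
    integrableOn_fracLap_kernel (by rw [finrank_euclideanSpace_fin, hp]; linarith) hε hmeas hint
      (v x) x
  have hWA : W ⊆ A := fun y (hy : lam < ‖y‖) => by
    have := norm_sub_norm_le y x
    change ε < ‖y - x‖
    linarith
  have hGB : IntegrableOn G B := (integrableOn_exterior_iff hlam F).1 (hFA.mono_set hWA)
  have hAsplit : A =ᵐ[volume] (B ∩ A ∪ W : Set _) := by
    have h0 : ∀ᵐ y : EuclideanSpace ℝ (Fin N), y ∉ ({0} : Set _) :=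
      measure_eq_zero_iff_ae_notMem.1 (measure_singleton 0)
    have h1 : ∀ᵐ y : EuclideanSpace ℝ (Fin N), y ∉ Metric.sphere 0 lam :=
      measure_eq_zero_iff_ae_notMem.1 (Measure.addHaar_sphere_of_ne_zero _ _ hlam.ne')
    filter_upwards [h0, h1] with y hy0 hy1
    apply propext
    change y ∈ A ↔ y ∈ B ∩ A ∪ W
    refine ⟨fun hy => ?_, fun hy => hy.elim (fun h => h.2) (fun h => hWA h)⟩
    rcases lt_trichotomy ‖y‖ lam with h | h | h
    · exact Or.inl ⟨⟨norm_pos_iff.mpr hy0, h⟩, hy⟩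
    · exact absurd (mem_sphere_zero_iff_norm.2 h) hy1
    · exact Or.inr h
  have hdisj : Disjoint (B ∩ A) W :=
    Set.disjoint_left.2 fun y hy hy' => (hy.1.2.trans hy').false
  have hFG : ∀ z ∈ B ∩ A, F z + G z ≤
      2 * v x / (‖x - EuclideanGeometry.inversion 0 lam z‖ * (‖z‖ / lam)) ^ p := by
    rintro z ⟨⟨hz0, hz1⟩, hz2⟩
    refine fracLap_kernel_add_inversion_le hs hNs hlam hx'.le hz0 hz1 ?_ hv hneg (hmin z hz0 hz1)
    rintro rfl
    rw [hA, mem_ofPred_eq, sub_self, norm_zero] at hz2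
    exact (hε.trans hz2).false
  have hFG0 : ∀ z ∈ B ∩ A, F z + G z ≤ 0 := fun z hz =>
    (hFG z hz).trans (div_nonpos_of_nonpos_of_nonneg (by linarith) (by positivity))
  have hSsub : S ⊆ B ∩ A := fun z hz => by
    obtain ⟨h0, h1, h2, -⟩ := near_sphere_ball_bounds hlam hδ hδlam hx hx' hz
    exact ⟨⟨h0, h1⟩, hεδ.trans h2⟩
  have hFGS : ∀ z ∈ S, F z + G z ≤ 2 * v x / (6 * δ) ^ p := fun z hz => by
    obtain ⟨h0, h1, h2, h3⟩ := near_sphere_ball_bounds hlam hδ hδlam hx hx' hz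
    have hD := norm_sub_le_dist_inversion_mul hlam (norm_pos_iff.mp h0) hx'.le h1.le
    rw [norm_sub_rev] at hD
    have hD0 := hδ.trans (h2.trans_le hD)
    refine (hFG z (hSsub hz)).trans
      (div_le_div_of_nonpos_left (by linarith) (Real.rpow_pos_of_pos hD0 p) ?_)
    exact Real.rpow_le_rpow (by positivity) h3 (by positivity)
  have hGnear : ∫ z in B \ A, G z ≤ 0 := by
    refine setIntegral_nonpos (hBm.diff hAm) fun z hz => ?_
    have hzx : ‖z - x‖ ≤ ε := not_lt.1 hz.2
    rw [hG, hF]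
    dsimp only
    rw [fracLap_kernel_inversion hlam hz.1.1 hv]
    refine div_nonpos_of_nonpos_of_nonneg (add_nonpos ?_ (hnear z hzx)) (by positivity)
    exact mul_nonpos_of_nonneg_of_nonpos (by positivity) hneg.le
  have hFGint : IntegrableOn (fun z => F z + G z) (B ∩ A) :=
    (hFA.mono_set inter_subset_right).add (hGB.mono_set inter_subset_left)
  calc ∫ y in A, F y
      = (∫ y in B ∩ A, F y) + ∫ y in W, F y := by
        rw [setIntegral_congr_set hAsplit, setIntegral_union hdisj hWm
          (hFA.mono_set inter_subset_right) (hFA.mono_set hWA)]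
    _ = (∫ y in B ∩ A, F y) + ((∫ z in B ∩ A, G z) + ∫ z in B \ A, G z) := by
        rw [integral_inter_add_sdiff hAm hGB, setIntegral_exterior_eq hlam F]
    _ ≤ (∫ y in B ∩ A, F y) + ∫ z in B ∩ A, G z := by linarith
    _ = ∫ z in B ∩ A, (F z + G z) :=
        (integral_add (hFA.mono_set inter_subset_right) (hGB.mono_set inter_subset_left)).symm
    _ ≤ ∫ z in S, (F z + G z) := by
        have := setIntegral_mono_set hFGint.neg
          ((ae_restrict_iff' (hBm.inter hAm)).2 (Eventually.of_forall fun z hz =>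
            neg_nonneg.2 (hFG0 z hz))) hSsub.eventuallyLE
        simpa only [Pi.neg_apply, integral_neg, neg_le_neg_iff] using this
    _ ≤ ∫ _ in S, 2 * v x / (6 * δ) ^ p :=
        setIntegral_mono_on (hFGint.mono_set hSsub)
          (integrableOn_const measure_ball_lt_top.ne) measurableSet_ball hFGS
    _ = 2 * v x / (6 * δ) ^ p * volume.real S := by
        rw [setIntegral_const, smul_eq_mul, mul_comm]

end Kelvin

lemma rpow_le_add_of_mem_Icc {a b t : ℝ} (α : ℝ) (ha : 0 < a) (hat : a ≤ t) (htb : t ≤ b) :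
    t ^ α ≤ a ^ α + b ^ α := by
  have ht := ha.trans_le hat
  rcases le_total 0 α with h | h
  · exact (Real.rpow_le_rpow ht.le htb h).trans (le_add_of_nonneg_left (by positivity))
  · exact (Real.rpow_le_rpow_of_nonpos ha hat h).trans
      (le_add_of_nonneg_right (Real.rpow_nonneg (ht.le.trans htb) α))

/-- **Maximum principle for narrow annular domains** (Lemma 3.1). -/
theorem narrow_domain_maximum_principle
    (N : ℕ) (hN : 0 < N) (s α lam Cbar : ℝ) (hs0 : 0 < s) (hs1 : s < 1)
    (hNs : 2 * s < (N : ℝ)) (hα : -2 * s < α) (hlam : 0 < lam) (hC : 0 < Cbar) :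
    ∃ δ₀ > 0, ∀ Ω : Set (EuclideanSpace ℝ (Fin N)),
      IsOpen Ω →
      Ω ⊆ {x : EuclideanSpace ℝ (Fin N) | lam - δ₀ < ‖x‖ ∧ ‖x‖ < lam} →
      ∀ v : EuclideanSpace ℝ (Fin N) → ℝ,
        Integrable (fun y : EuclideanSpace ℝ (Fin N) =>
          |v y| / (1 + ‖y‖ ^ ((N : ℝ) + 2 * s))) →
        (∀ x : EuclideanSpace ℝ (Fin N), x ≠ 0 → C11Near N v x) →
        ContinuousOn v {x : EuclideanSpace ℝ (Fin N) | 0 < ‖x‖ ∧ ‖x‖ ≤ lam} →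
        (∀ x : EuclideanSpace ℝ (Fin N), x ≠ 0 →
          v x = - kelvinTransform N s lam v x) →
        (∀ x ∈ Ω, ∃ L : ℝ, IsFracLapAt N s v x L ∧ Cbar * ‖x‖ ^ α * v x ≤ L) →
        (∀ x : EuclideanSpace ℝ (Fin N), 0 < ‖x‖ → ‖x‖ < lam → x ∉ Ω → 0 ≤ v x) →
        ∀ x ∈ Ω, 0 ≤ v x := by
  have : Nonempty (Fin N) := ⟨⟨0, hN⟩⟩
  set p : ℝ := (N : ℝ) + 2 * s with hp
  set κ : ℝ := volume.real (Metric.ball (0 : EuclideanSpace ℝ (Fin N)) 1) with hκ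
  have hκ0 : 0 < κ :=
    ENNReal.toReal_pos (Metric.measure_ball_pos _ _ one_pos).ne' measure_ball_lt_top.ne
  have hsmall : ∀ᶠ δ : ℝ in nhdsWithin 0 (Ioi 0), δ ∈ Ioc 0 (lam / 10) ∧
      Cbar * ((lam / 2) ^ α + lam ^ α) * 6 ^ p / (2 * κ) < δ ^ (-(2 * s)) :=
    Filter.Eventually.and (Ioc_mem_nhdsGT (by positivity))
      ((tendsto_rpow_neg_nhdsGT_zero (by linarith)).eventually (eventually_gt_atTop _))
  obtain ⟨δ, ⟨hδ, hδlam⟩, hδC⟩ := hsmall.exists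
  refine ⟨δ, hδ, fun Ω _ hΩ v hint hC11 hcont hanti hlap hout x₁ hx₁ => ?_⟩
  by_contra! hx₁neg
  obtain ⟨x, hxK, hxmin⟩ : ∃ x ∈ {x : EuclideanSpace ℝ (Fin N) | lam - δ ≤ ‖x‖ ∧ ‖x‖ ≤ lam},
      IsMinOn v {x : EuclideanSpace ℝ (Fin N) | lam - δ ≤ ‖x‖ ∧ ‖x‖ ≤ lam} x := by
    have hK : IsCompact {x : EuclideanSpace ℝ (Fin N) | lam - δ ≤ ‖x‖ ∧ ‖x‖ ≤ lam} :=
      (isCompact_closedBall (0 : EuclideanSpace ℝ (Fin N)) lam).of_isClosed_subset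
        ((isClosed_le continuous_const continuous_norm).inter
          (isClosed_le continuous_norm continuous_const)) fun x hx => by simpa using hx.2
    exact hK.exists_isMinOn ⟨x₁, (hΩ hx₁).1.le, (hΩ hx₁).2.le⟩
      (hcont.mono fun x hx => ⟨by linarith [hx.1], hx.2⟩)
  have hneg : v x < 0 :=
    (isMinOn_iff.1 hxmin x₁ ⟨(hΩ hx₁).1.le, (hΩ hx₁).2.le⟩).trans_lt hx₁neg
  have hx0 : 0 < ‖x‖ := by linarith [hxK.1]
  have hxlam : ‖x‖ < lam := by
    refine hxK.2.lt_of_ne fun h => ?_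
    have := hanti x (norm_pos_iff.mp hx0)
    rw [kelvinTransform, h, div_self hlam.ne', div_self (by positivity), Real.one_rpow, one_smul,
      one_mul] at this
    linarith
  have hxΩ : x ∈ Ω := by
    by_contra h
    exact (hout x hx0 hxlam h).not_gt hneg
  have hmin : ∀ z, 0 < ‖z‖ → ‖z‖ < lam → v x ≤ v z := fun z hz hz' => by
    by_cases h : z ∈ Ω
    · exact isMinOn_iff.1 hxmin z ⟨(hΩ h).1.le, hz'.le⟩
    · exact hneg.le.trans (hout z hz hz' h)
  obtain ⟨L, hL, hLv⟩ := hlap x hxΩ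
  obtain ⟨r, hr, hrneg⟩ := Metric.eventually_nhds_iff.1
    ((hC11 x (norm_pos_iff.mp hx0)).continuousAt.eventually_lt_const hneg)
  have hLle : L ≤ 2 * v x / (6 * δ) ^ p *
      volume.real (Metric.ball ((1 - 3 * δ / ‖x‖) • x) δ) := by
    refine le_of_tendsto hL ?_
    filter_upwards [Ioo_mem_nhdsGT (lt_min (lt_min hδ (sub_pos.2 hxlam)) hr)] with ε hε
    obtain ⟨h12, h3⟩ := lt_min_iff.1 hε.2
    obtain ⟨h1, h2⟩ := lt_min_iff.1 h12
    exact truncated_fracLap_le_of_negative_min hN hs0 hNs hlam hδ (by linarith) (hΩ hxΩ).1 hxlam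
      hε.1 h1 h2 (aestronglyMeasurable_of_continuousAt_ne_zero fun y hy => (hC11 y hy).continuousAt)
      hint hanti hneg hmin fun z hz => (hrneg (by rw [dist_eq_norm]; exact hz.trans_lt h3)).le
  have hvol : volume.real (Metric.ball ((1 - 3 * δ / ‖x‖) • x) δ) = δ ^ N * κ := by
    rw [measureReal_def, Measure.addHaar_ball _ _ hδ.le, finrank_euclideanSpace_fin,
      ENNReal.toReal_mul, ENNReal.toReal_ofReal (by positivity), hκ, measureReal_def]
  have hscale : 2 * v x / (6 * δ) ^ p * (δ ^ N * κ) =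
      v x * (δ ^ (-(2 * s)) * (2 * κ) / 6 ^ p) := by
    rw [Real.mul_rpow (by norm_num) hδ.le, hp, Real.rpow_add hδ, Real.rpow_natCast,
      Real.rpow_neg hδ.le]
    field_simp
  have hpow : ‖x‖ ^ α ≤ (lam / 2) ^ α + lam ^ α :=
    rpow_le_add_of_mem_Icc α (by positivity) (by linarith [hxK.1]) hxlam.le
  have hlt : Cbar * ‖x‖ ^ α < δ ^ (-(2 * s)) * (2 * κ) / 6 ^ p := by
    rw [div_lt_iff₀ (by positivity)] at hδC
    rw [lt_div_iff₀ (by positivity)]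
    refine lt_of_le_of_lt ?_ hδC
    gcongr
  rw [hvol, hscale] at hLle
  have := mul_lt_mul_of_neg_left hlt hneg
  linarith
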